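/- For every list of columns s : List (Fin n) and every column i : Fin n, Refine(rk_s, i) = rk_{s++[i]}; that is, for every row j, rk_s(j) + numNewID_{rk_s,i}(rk_s(j)) + subID_{rk_s,i}(j) = rk_{s++[i]}(j). In other words, refining the ranking vector of the lexicographical sorting by s with column i yields exactly the ranking vector of the lexicographical sorting by s++[i]. -/

import Mathlib

open scoped Classical

noncomputable def key {m n : ℕ} (D : Fin m → Fin n → ℝ) (s : List (Fin n)) (j : Fin m) :
    List ℝ := s.map (fun a => D j a)

noncomputable def rk {m n : ℕ} (D : Fin m → Fin n → ℝ) (s : List (Fin n)) (j : Fin m) : ℕ :=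
  ((Finset.univ.image (key D s)).filter (fun v => List.Lex (· < ·) v (key D s j))).card

noncomputable def subID {m n : ℕ} (D : Fin m → Fin n → ℝ) (L : Fin m → ℕ) (i : Fin n)
    (j : Fin m) : ℕ :=
  ((Finset.univ.filter (fun k => L k = L j ∧ D k i < D j i)).image (fun k => D k i)).card

noncomputable def newCount {m n : ℕ} (D : Fin m → Fin n → ℝ) (L : Fin m → ℕ) (i : Fin n)
    (r : ℕ) : ℕ :=
  if (Finset.univ.filter (fun k => L k = r)).Nonempty then
    ((Finset.univ.filter (fun k => L k = r)).image (fun k => D k i)).card - 1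
  else 0

noncomputable def numNewID {m n : ℕ} (D : Fin m → Fin n → ℝ) (L : Fin m → ℕ) (i : Fin n)
    (r : ℕ) : ℕ :=
  ∑ l ∈ Finset.range r, newCount D L i l

noncomputable def Refine {m n : ℕ} (D : Fin m → Fin n → ℝ) (L : Fin m → ℕ) (i : Fin n)
    (j : Fin m) : ℕ :=
  L j + numNewID D L i (L j) + subID D L i j

theorem List.lex_concat_iff {α : Type*} {r : α → α → Prop} (hr : ∀ a, ¬ r a a) {a b : α} :
    ∀ {u v : List α}, u.length = v.length →
      (List.Lex r (u ++ [a]) (v ++ [b]) ↔ List.Lex r u v ∨ u = v ∧ r a b)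
  | [], [], _ => by simp [List.cons_lex_cons_iff]
  | x :: u, y :: v, h => by
    have ih := List.lex_concat_iff (a := a) (b := b) hr (u := u) (v := v) (by simpa using h)
    simp only [List.cons_append, List.cons_lex_cons_iff, ih, List.cons.injEq]
    tauto

theorem Finset.image_card_filter_lt {α : Type*} [LinearOrder α] [DecidableLT α] (S : Finset α) (a : α) :
    (S.filter (· < a)).image (fun u => (S.filter (· < u)).card)
      = Finset.range (S.filter (· < a)).card := by
  have hlt : ∀ u ∈ S, ∀ v, u < v → (S.filter (· < u)).card < (S.filter (· < v)).card := by
    intro u hu v huv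
    refine Finset.card_lt_card ⟨fun w hw => ?_, fun h => ?_⟩
    · rw [Finset.mem_filter] at hw ⊢
      exact ⟨hw.1, hw.2.trans huv⟩
    · exact lt_irrefl u (Finset.mem_filter.1 (h (Finset.mem_filter.2 ⟨hu, huv⟩))).2
  refine Finset.eq_of_subset_of_card_le ?_ ?_
  · intro l hl
    obtain ⟨u, hu, rfl⟩ := Finset.mem_image.1 hl
    rw [Finset.mem_filter] at hu
    exact Finset.mem_range.2 (hlt u hu.1 a hu.2)
  · rw [Finset.card_range, Finset.card_image_of_injOn]
    intro u hu v hv huv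
    have hu' := (Finset.mem_filter.1 hu).1
    have hv' := (Finset.mem_filter.1 hv).1
    rcases lt_trichotomy u v with h | h | h
    · exact absurd huv (hlt u hu' v h).ne
    · exact h
    · exact absurd huv (hlt v hv' u h).ne'

section Ranking

variable {m n : ℕ} (D : Fin m → Fin n → ℝ) (s : List (Fin n))

theorem rk_eq_card_filter_lt (j : Fin m) :
    rk D s j = ((Finset.univ.image (key D s)).filter (· < key D s j)).card := by
  unfold rk
  congr 1
  ext v
  simp only [Finset.mem_filter]
  rfl

theorem rk_lt_rk {j k : Fin m} (h : key D s k < key D s j) : rk D s k < rk D s j := by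
  have := Finset.image_card_filter_lt (Finset.univ.image (key D s)) (key D s j)
  rw [rk_eq_card_filter_lt, rk_eq_card_filter_lt, ← Finset.mem_range, ← this]
  exact Finset.mem_image_of_mem _
    (Finset.mem_filter.2 ⟨Finset.mem_image_of_mem _ (Finset.mem_univ k), h⟩)

theorem rk_lt_rk_iff {j k : Fin m} : rk D s k < rk D s j ↔ key D s k < key D s j := by
  refine ⟨fun h => ?_, rk_lt_rk D s⟩
  rcases lt_trichotomy (key D s k) (key D s j) with h' | h' | h'
  · exact h'
  · simp [rk, h'] at h
  · exact absurd h (rk_lt_rk D s h').not_gt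

theorem rk_eq_rk_iff {j k : Fin m} : rk D s k = rk D s j ↔ key D s k = key D s j := by
  rw [← not_iff_not, ← ne_eq, ← ne_eq, ne_iff_lt_or_gt, ne_iff_lt_or_gt,
    rk_lt_rk_iff, rk_lt_rk_iff]

theorem exists_rk_eq_of_lt {j : Fin m} {l : ℕ} (h : l < rk D s j) : ∃ k, rk D s k = l := by
  rw [rk_eq_card_filter_lt, ← Finset.mem_range, ← Finset.image_card_filter_lt,
    Finset.mem_image] at h
  obtain ⟨u, hu, rfl⟩ := h
  obtain ⟨k, -, rfl⟩ := Finset.mem_image.1 (Finset.mem_filter.1 hu).1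
  exact ⟨k, rk_eq_card_filter_lt D s k⟩

theorem key_concat (i : Fin n) (j : Fin m) : key D (s ++ [i]) j = key D s j ++ [D j i] := by
  simp [key]

theorem lex_key_concat_iff (i : Fin n) (j k : Fin m) :
    List.Lex (· < ·) (key D (s ++ [i]) k) (key D (s ++ [i]) j) ↔
      rk D s k < rk D s j ∨ rk D s k = rk D s j ∧ D k i < D j i := by
  rw [key_concat, key_concat, List.lex_concat_iff lt_irrefl (by simp [key]), rk_lt_rk_iff,
    rk_eq_rk_iff]
  rfl

/-- On rows of equal rank, the extended keys are counted by the entries of the new column. -/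
theorem card_image_key_concat (i : Fin n) {A : Finset (Fin m)} {r : ℕ}
    (hA : ∀ k ∈ A, rk D s k = r) :
    (A.image (key D (s ++ [i]))).card = (A.image (fun k => D k i)).card := by
  rcases A.eq_empty_or_nonempty with rfl | ⟨j, hj⟩
  · simp
  have : A.image (key D (s ++ [i])) =
      (A.image (fun k => D k i)).image (fun x => key D s j ++ [x]) := by
    rw [Finset.image_image]
    refine Finset.image_congr fun k hk => ?_
    have := (rk_eq_rk_iff D s).1 ((hA k hk).trans (hA j hj).symm)
    simp [key_concat, this]
  rw [this, Finset.card_image_of_injective]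
  intro x y h
  simpa using h

theorem card_image_rk_eq (i : Fin n) {j : Fin m} {l : ℕ} (hl : l < rk D s j) :
    ((Finset.univ.filter (fun k => rk D s k = l)).image (key D (s ++ [i]))).card
      = newCount D (rk D s) i l + 1 := by
  obtain ⟨k, hk⟩ := exists_rk_eq_of_lt D s hl
  have hne : (Finset.univ.filter (fun k => rk D s k = l)).Nonempty := ⟨k, by simp [hk]⟩
  rw [card_image_key_concat D s i (r := l) (by simp), newCount, if_pos hne,
    Nat.sub_add_cancel (hne.image _).card_pos]

theorem key_eq_of_key_concat_eq {i : Fin n} {j k : Fin m}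
    (h : key D (s ++ [i]) k = key D (s ++ [i]) j) : key D s k = key D s j := by
  rw [key_concat, key_concat] at h
  exact (List.append_inj' h rfl).1

theorem card_image_rk_lt (i : Fin n) (j : Fin m) :
    ((Finset.univ.filter (fun k => rk D s k < rk D s j)).image (key D (s ++ [i]))).card
      = rk D s j + numNewID D (rk D s) i (rk D s j) := by
  have hA : Finset.univ.filter (fun k => rk D s k < rk D s j) =
      (Finset.range (rk D s j)).biUnion
        (fun l => Finset.univ.filter (fun k => rk D s k = l)) := by
    ext k
    simp
  rw [hA, Finset.biUnion_image, Finset.card_biUnion,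
    Finset.sum_congr rfl fun l hl => card_image_rk_eq D s i (Finset.mem_range.1 hl),
    Finset.sum_add_distrib, numNewID]
  · simp [add_comm]
  · intro a _ b _ hab
    refine Finset.disjoint_left.2 fun v hv hw => ?_
    simp only [Finset.mem_image, Finset.mem_filter, Finset.mem_univ, true_and] at hv hw
    obtain ⟨k, rfl, rfl⟩ := hv
    obtain ⟨k', rfl, h⟩ := hw
    exact hab ((rk_eq_rk_iff D s).2 (key_eq_of_key_concat_eq D s h).symm)

theorem rk_concat_eq_card (i : Fin n) (j : Fin m) :
    rk D (s ++ [i]) j = ((Finset.univ.filter (fun k => rk D s k < rk D s j ∨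
      rk D s k = rk D s j ∧ D k i < D j i)).image (key D (s ++ [i]))).card := by
  rw [rk, Finset.filter_image]
  simp only [lex_key_concat_iff]

end Ranking

theorem refine_rk_eq_rk_append {m n : ℕ} (hm : 1 ≤ m)
    (D : Fin m → Fin n → ℝ) (s : List (Fin n)) (i : Fin n) :
    ∀ j : Fin m,
      rk D s j + numNewID D (rk D s) i (rk D s j) + subID D (rk D s) i j
        = rk D (s ++ [i]) j := by
  intro j
  rw [← card_image_rk_lt, subID,
    ← card_image_key_concat D s i (r := rk D s j) (fun k hk => (Finset.mem_filter.1 hk).2.1),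
    ← Finset.card_union_of_disjoint, ← Finset.image_union, ← Finset.filter_or,
    rk_concat_eq_card]
  · rw [Finset.disjoint_left]
    intro v hv hw
    simp only [Finset.mem_image, Finset.mem_filter, Finset.mem_univ, true_and] at hv hw
    obtain ⟨k, hk, rfl⟩ := hv
    obtain ⟨k', ⟨hk', -⟩, h⟩ := hw
    have := (rk_eq_rk_iff D s).2 (key_eq_of_key_concat_eq D s h)
    omega
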